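/- For every p ∈ (1,∞) and q ∈ [1,∞] there are constants C > 0 and γ > 0 such that for every ball B_r ⊂ ℝⁿ, every Λ ≥ 1 and every φ ∈ C_c^∞(B_r): ‖ (Δ^{n/4} η_{Λr}) · (Δ^{−n/4} φ) ‖_{(p,q),ℝⁿ} ≤ C Λ^{−γ} ‖φ‖_{(p,∞),ℝⁿ}, where η_{Λr} is the cutoff at scale Λr concentric with B_r. -/

import Mathlib

open MeasureTheory Real FourierTransform Metric Set Matrix
open scoped ENNReal Topology NNReal

noncomputable section

abbrev Eucl (n : ℕ) : Type := EuclideanSpace ℝ (Fin n)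

/-- The fractional Laplacian `Δ^{s/2}`: Fourier multiplier with symbol `(2π|ξ|)^s`. -/
noncomputable def fracLap {n : ℕ} (s : ℝ) (f : Eucl n → ℝ) : Eucl n → ℝ :=
  fun x => (𝓕⁻ (fun ξ : Eucl n =>
    (((2 * π * ‖ξ‖) ^ s : ℝ) : ℂ) * 𝓕 (fun y : Eucl n => (f y : ℂ)) ξ) x).re

/-- The normalizing constant of the Riesz potential `Δ^{-s/2}`. -/
noncomputable def rieszConst (n : ℕ) (s : ℝ) : ℝ :=
  Real.Gamma ((n - s) / 2) / (2 ^ s * π ^ ((n : ℝ) / 2) * Real.Gamma (s / 2))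

/-- The Riesz potential `Δ^{-s/2}`, convolution with `c_s |x|^{s-n}`. -/
noncomputable def rieszPot {n : ℕ} (s : ℝ) (f : Eucl n → ℝ) : Eucl n → ℝ :=
  fun x => rieszConst n s * ∫ y : Eucl n, ‖x - y‖ ^ (s - (n : ℝ)) * f y

/-- The three-commutator `H(a,b) = Δ^{n/4}(ab) - a Δ^{n/4} b - b Δ^{n/4} a`. -/
noncomputable def Hcomm {n : ℕ} (a b : Eucl n → ℝ) : Eucl n → ℝ :=
  fun x => fracLap ((n : ℝ) / 2) (fun y => a y * b y) x
    - a x * fracLap ((n : ℝ) / 2) b x - b x * fracLap ((n : ℝ) / 2) a x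

/-- The decreasing rearrangement of `f`. -/
noncomputable def decRear {n : ℕ} (f : Eucl n → ℝ) (t : ℝ) : ℝ≥0∞ :=
  ⨅ (s : ℝ≥0) (_ : volume {x : Eucl n | (s : ℝ) < |f x|} ≤ ENNReal.ofReal t), (s : ℝ≥0∞)

/-- The Lorentz quasinorm `‖f‖_{(p,q)}`. -/
noncomputable def lorentzNorm {n : ℕ} (p q : ℝ≥0∞) (f : Eucl n → ℝ) : ℝ≥0∞ :=
  if q = ∞ then
    (if p = ∞ then eLpNormEssSup f volume
     else ⨆ t : {t : ℝ // 0 < t}, ENNReal.ofReal (t.1 ^ (1 / p).toReal) * decRear f t.1)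
  else
    (∫⁻ t in Set.Ioi (0 : ℝ),
        (ENNReal.ofReal (t ^ (1 / p).toReal) * decRear f t) ^ q.toReal / ENNReal.ofReal t) ^
      (1 / q.toReal)

/-- The Lorentz quasinorm of `f` restricted to a set `A`. -/
noncomputable def lorentzNormOn {n : ℕ} (p q : ℝ≥0∞) (A : Set (Eucl n)) (f : Eucl n → ℝ) : ℝ≥0∞ :=
  lorentzNorm p q (A.indicator f)

/-- Smooth compactly supported test function with support in `D`. -/
def IsTestFn {n : ℕ} (D : Set (Eucl n)) (φ : Eucl n → ℝ) : Prop :=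
  ContDiff ℝ (⊤ : ℕ∞) φ ∧ HasCompactSupport φ ∧ tsupport φ ⊆ D

/-- A symbol of a zero-multiplier operator: smooth away from `0`, homogeneous of degree `0`. -/
def IsZeroSymbol {n : ℕ} (m : Eucl n → ℂ) : Prop :=
  ContDiffOn ℝ (⊤ : ℕ∞) m {0}ᶜ ∧ ∀ c : ℝ, 0 < c → ∀ x : Eucl n, m (c • x) = m x

/-- The zero-multiplier operator with symbol `m`. -/
noncomputable def zeroMultOp {n : ℕ} (m : Eucl n → ℂ) (f : Eucl n → ℝ) : Eucl n → ℝ :=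
  fun x => (𝓕⁻ (fun ξ : Eucl n => m ξ * 𝓕 (fun y : Eucl n => (f y : ℂ)) ξ) x).re

/-- A real kernel profile: smooth away from `0` and homogeneous of degree `0`
(equivalently, a smooth function of `x/|x|`). -/
def IsZeroHomogeneous {n : ℕ} (m : Eucl n → ℝ) : Prop :=
  ContDiffOn ℝ (⊤ : ℕ∞) m {0}ᶜ ∧ ∀ c : ℝ, 0 < c → ∀ x : Eucl n, m (c • x) = m x


/-- `D` is a smoothly bounded domain: the sublevel set of a smooth function with
nonvanishing gradient on the boundary. -/
def HasSmoothBoundary {n : ℕ} (D : Set (Eucl n)) : Prop :=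
  ∃ f : Eucl n → ℝ, ContDiff ℝ (⊤ : ℕ∞) f ∧ D = {x | f x < 0} ∧
    ∀ x ∈ frontier D, fderiv ℝ f x ≠ 0

theorem memLp_fourierInv {n : ℕ} (H : Eucl n → ℂ) (h1 : Integrable H) (h2 : MemLp H 2 volume) :
    MemLp (𝓕⁻ H) 2 volume := by
  have hcont : Continuous (𝓕⁻ H) := by
    have := VectorFourier.fourierIntegral_continuous Real.continuous_fourierChar
      (L := -(innerₗ (Eucl n))) (by simp only [LinearMap.neg_apply, innerₗ_apply_apply]; fun_prop) h1
    exact this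
  set h : Lp ℂ 2 (volume : Measure (Eucl n)) := 𝓕⁻ (h2.toLp H) with hh
  have key : (h : Eucl n → ℂ) =ᵐ[volume] 𝓕⁻ H := by
    refine ae_eq_of_integral_contDiff_smul_eq (μ := volume) ?_ ?_ ?_
    · exact (Lp.memLp h).locallyIntegrable (μ := volume) (by norm_num)
    · exact hcont.locallyIntegrable
    intro g hg hgc
    have hg₁ : HasCompactSupport (fun x => (g x : ℂ)) := hgc.comp_left Complex.ofReal_zero
    have hg₂ : ContDiff ℝ (⊤ : ℕ∞) (fun x => (g x : ℂ)) := Complex.ofRealCLM.contDiff.comp hg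
    set G := hg₁.toSchwartzMap hg₂ with hG
    have e1 := Lp.fourierInv_toTemperedDistribution_eq (h2.toLp H)
    have e2 := DFunLike.congr_fun e1 G
    rw [← hh, Lp.toTemperedDistribution_apply, TemperedDistribution.fourierInv_apply,
      Lp.toTemperedDistribution_apply] at e2
    have e3 : ∫ x, (𝓕⁻ G) x • (h2.toLp H : Eucl n → ℂ) x = ∫ x, (𝓕⁻ G) x • H x := by
      apply integral_congr_ae
      filter_upwards [h2.coeFn_toLp] with x hx
      rw [hx]
    rw [e3] at e2
    have e4 : ∫ x, (𝓕⁻ G) x • H x = ∫ x, G x • (𝓕⁻ H) x := by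
      have := VectorFourier.integral_fourierIntegral_smul_eq_flip (L := -(innerₗ (Eucl n))) (μ := volume) (ν := volume)
        Real.continuous_fourierChar (by simp only [LinearMap.neg_apply, innerₗ_apply_apply]; fun_prop) (f := G) (g := H) G.integrable h1
      rw [SchwartzMap.fourierInv_coe]
      have hf : (-(innerₗ (Eucl n))).flip = -(innerₗ (Eucl n)) := by
        ext x y; simp [real_inner_comm]
      rw [hf] at this
      exact this
    rw [e4] at e2
    simpa [hG] using e2.symm
  exact (memLp_congr_ae key).1 (Lp.memLp h)

theorem fracLap_scale {n : ℕ} (s : ℝ) (f : Eucl n → ℝ) (x₀ x : Eucl n) (R : ℝ) (hR : 0 < R) :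
    fracLap s (fun y => f (R⁻¹ • (y - x₀))) x = R ^ (-s) * fracLap s f (R⁻¹ • (x - x₀)) := by
  have hRn : (0:ℝ) < R ^ n := by positivity
  have hF : ∀ ξ : Eucl n, 𝓕 (fun y : Eucl n => ((f (R⁻¹ • (y - x₀)) : ℝ) : ℂ)) ξ
      = ((R ^ n : ℝ) : ℂ) * (𝐞 (-(inner ℝ x₀ ξ)) : ℂ) * 𝓕 (fun y : Eucl n => (f y : ℂ)) (R • ξ) := by
    intro ξ
    rw [Real.fourier_eq, Real.fourier_eq]
    have h1 := integral_sub_right_eq_self (μ := (volume : Measure (Eucl n)))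
      (fun y => 𝐞 (-inner ℝ (y + x₀) ξ) • ((f (R⁻¹ • y) : ℝ) : ℂ)) x₀
    simp only [sub_add_cancel] at h1
    rw [h1]
    have h2 := Measure.integral_comp_inv_smul (μ := (volume : Measure (Eucl n)))
      (fun y => 𝐞 (-inner ℝ (R • y + x₀) ξ) • ((f y : ℝ) : ℂ)) R
    simp only [smul_inv_smul₀ hR.ne', finrank_euclideanSpace, Fintype.card_fin,
      abs_of_pos hRn] at h2
    rw [h2, Complex.real_smul, mul_assoc, ← integral_const_mul, ← integral_const_mul, ← integral_const_mul]
    refine integral_congr_ae (ae_of_all _ fun y => ?_)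
    simp only
    rw [inner_add_left, neg_add, AddChar.map_add_eq_mul, real_inner_smul_left, real_inner_smul_right]
    simp only [Circle.smul_def, Circle.coe_mul, smul_eq_mul]
    ring
  have key : 𝓕⁻ (fun ξ : Eucl n => (((2 * π * ‖ξ‖) ^ s : ℝ) : ℂ) *
        𝓕 (fun y : Eucl n => ((f (R⁻¹ • (y - x₀)) : ℝ) : ℂ)) ξ) x
      = ((R ^ (-s) : ℝ) : ℂ) * 𝓕⁻ (fun ξ : Eucl n => (((2 * π * ‖ξ‖) ^ s : ℝ) : ℂ) *
        𝓕 (fun y : Eucl n => (f y : ℂ)) ξ) (R⁻¹ • (x - x₀)) := by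
    rw [Real.fourierInv_eq, Real.fourierInv_eq]
    have h2 := Measure.integral_comp_smul (μ := (volume : Measure (Eucl n)))
      (fun ξ => 𝐞 (inner ℝ ξ (R⁻¹ • (x - x₀))) • ((((2 * π * ‖ξ‖) ^ s : ℝ) : ℂ) *
        𝓕 (fun y : Eucl n => (f y : ℂ)) ξ)) R
    simp only [finrank_euclideanSpace, Fintype.card_fin, abs_inv,
      abs_of_pos hRn] at h2
    have h3 : ∫ ξ, 𝐞 (inner ℝ ξ (R⁻¹ • (x - x₀))) • ((((2 * π * ‖ξ‖) ^ s : ℝ) : ℂ) *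
        𝓕 (fun y : Eucl n => (f y : ℂ)) ξ) = ((R ^ n : ℝ) : ℂ) * ∫ ξ : Eucl n, 𝐞 (inner ℝ (R • ξ) (R⁻¹ • (x - x₀))) • ((((2 * π * ‖R • ξ‖) ^ s : ℝ) : ℂ) *
        𝓕 (fun y : Eucl n => (f y : ℂ)) (R • ξ)) := by
      rw [h2, Complex.real_smul, ← mul_assoc, ← Complex.ofReal_mul, mul_inv_cancel₀ hRn.ne']
      simp
    rw [h3, ← integral_const_mul, ← integral_const_mul]
    congr 1
    ext ξ
    rw [hF]
    have e1 : inner ℝ (R • ξ) (R⁻¹ • (x - x₀)) = inner ℝ ξ x + -(inner ℝ x₀ ξ) := by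
      rw [real_inner_smul_left, real_inner_smul_right, inner_sub_right, real_inner_comm ξ x₀]
      field_simp
      ring
    have e2 : (2 * π * ‖R • ξ‖) ^ s = R ^ s * (2 * π * ‖ξ‖) ^ s := by
      rw [norm_smul, Real.norm_of_nonneg hR.le, ← Real.mul_rpow hR.le (by positivity)]
      congr 1; ring
    have e3 : ((R ^ (-s) : ℝ) : ℂ) * ((R ^ s : ℝ) : ℂ) = 1 := by
      rw [← Complex.ofReal_mul, ← Real.rpow_add hR]; simp
    rw [e1, e2, AddChar.map_add_eq_mul]
    simp only [Circle.smul_def, Circle.coe_mul, smul_eq_mul, Complex.ofReal_mul]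
    linear_combination (-((R ^ n : ℝ) : ℂ) * (𝐞 (inner ℝ ξ x) : ℂ) * (𝐞 (-(inner ℝ x₀ ξ)) : ℂ) * (((2 * π * ‖ξ‖) ^ s : ℝ) : ℂ) * 𝓕 (fun y : Eucl n => (f y : ℂ)) (R • ξ)) * e3
  unfold fracLap
  rw [key, Complex.re_ofReal_mul]

theorem rieszPot_scale {n : ℕ} (s : ℝ) (f : Eucl n → ℝ) (x₀ x : Eucl n) (r : ℝ) (hr : 0 < r) :
    rieszPot s f x = r ^ s * rieszPot s (fun z => f (x₀ + r • z)) (r⁻¹ • (x - x₀)) := by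
  have hrn : (0:ℝ) < r ^ n := by positivity
  unfold rieszPot
  rw [mul_left_comm]
  congr 1
  have h1 := integral_add_left_eq_self (μ := (volume : Measure (Eucl n)))
      (fun y => ‖x - y‖ ^ (s - (n:ℝ)) * f y) x₀
  have h2 := Measure.integral_comp_smul (μ := (volume : Measure (Eucl n)))
      (fun y => ‖x - (x₀ + y)‖ ^ (s - (n:ℝ)) * f (x₀ + y)) r
  simp only [finrank_euclideanSpace, Fintype.card_fin, abs_inv, abs_of_pos hrn, smul_eq_mul] at h2
  rw [← h1, ← integral_const_mul]
  have h3 : ∫ y, ‖x - (x₀ + y)‖ ^ (s - (n:ℝ)) * f (x₀ + y) =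
    r ^ n * ∫ y, ‖x - (x₀ + r • y)‖ ^ (s - (n:ℝ)) * f (x₀ + r • y) := by
    rw [h2, ← mul_assoc, mul_inv_cancel₀ hrn.ne', one_mul]
  rw [h3, ← integral_const_mul]
  congr 1
  ext y
  have e : x - (x₀ + r • y) = r • (r⁻¹ • (x - x₀) - y) := by
    rw [smul_sub, smul_inv_smul₀ hr.ne']; abel
  rw [e, norm_smul, Real.norm_of_nonneg hr.le, Real.mul_rpow hr.le (norm_nonneg _),
    ← Real.rpow_natCast, ← mul_assoc, ← mul_assoc, ← Real.rpow_add hr]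
  ring_nf

theorem fracLap_eta {n : ℕ} (s : ℝ) (hs : 0 < s)
    (η : Eucl n → ℝ) (hη : ContDiff ℝ (⊤ : ℕ∞) η) (hc : HasCompactSupport η) :
    Continuous (fracLap s η) ∧ ∀ a : ℝ, 2 ≤ a → ∫⁻ x, ‖fracLap s η x‖ₑ ^ a < ∞ := by
  have hg₁ : HasCompactSupport (fun x => (η x : ℂ)) := hc.comp_left Complex.ofReal_zero
  have hg₂ : ContDiff ℝ (⊤ : ℕ∞) (fun x => (η x : ℂ)) := Complex.ofRealCLM.contDiff.comp hη
  set S := 𝓕 (hg₁.toSchwartzMap hg₂) with hS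
  have hSe : 𝓕 (fun y : Eucl n => (η y : ℂ)) = S := by
    rw [hS, SchwartzMap.fourier_coe]; rfl
  set H : Eucl n → ℂ := fun ξ => (((2 * π * ‖ξ‖) ^ s : ℝ) : ℂ) * 𝓕 (fun y : Eucl n => (η y : ℂ)) ξ with hH
  have hHcont : Continuous H := by
    rw [hH, hSe]
    have h1 : Continuous (fun ξ : Eucl n => (2 * π * ‖ξ‖) ^ s) :=
      Continuous.rpow_const (by fun_prop) (fun _ => Or.inr hs.le)
    exact (Complex.continuous_ofReal.comp h1).mul S.continuous
  obtain ⟨k, hk⟩ := exists_nat_gt s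
  have hkbd : ∀ ξ : Eucl n, (2 * π * ‖ξ‖) ^ s ≤ (2*π)^s * (1 + ‖ξ‖ ^ k) := by
    intro ξ
    rw [Real.mul_rpow (by positivity) (norm_nonneg _)]
    gcongr
    rcases le_total ‖ξ‖ 1 with h | h
    · have := Real.rpow_le_one (norm_nonneg ξ) h hs.le
      have : 0 ≤ ‖ξ‖ ^ k := by positivity
      linarith
    · have := Real.rpow_le_rpow_of_exponent_le h hk.le
      rw [Real.rpow_natCast] at this
      linarith
  have hHn : ∀ ξ, ‖H ξ‖ ≤ (2*π)^s * (‖S ξ‖ + ‖ξ‖ ^ k * ‖S ξ‖) := by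
    intro ξ
    rw [hH]; simp only
    rw [norm_mul, Complex.norm_real, Real.norm_of_nonneg (by positivity), hSe]
    calc _ ≤ ((2*π)^s * (1 + ‖ξ‖ ^ k)) * ‖S ξ‖ := by gcongr; exact hkbd ξ
      _ = _ := by ring
  have hI : Integrable H := by
    have i0 := S.integrable (μ := volume)
    have ik := S.integrable_pow_mul volume k
    exact ((i0.norm.add ik).const_mul _).mono' hHcont.aestronglyMeasurable (ae_of_all _ hHn)
  obtain ⟨B, hB⟩ : ∃ B, ∀ ξ, ‖H ξ‖ ≤ B := by
    obtain ⟨C0, h0⟩ := S.decay 0 0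
    obtain ⟨C1, h1⟩ := S.decay k 0
    refine ⟨(2*π)^s * (C0 + C1), fun ξ => (hHn ξ).trans ?_⟩
    have a0 := h0.2 ξ
    have a1 := h1.2 ξ
    simp only [pow_zero, one_mul, norm_iteratedFDeriv_zero] at a0 a1
    gcongr
  have h2 : MemLp H 2 volume := by
    rw [memLp_two_iff_integrable_sq_norm hHcont.aestronglyMeasurable]
    refine (hI.norm.const_mul B).mono' (by fun_prop) (ae_of_all _ fun x => ?_)
    rw [Real.norm_of_nonneg (by positivity), sq]
    gcongr
    exact hB x
  have hF2 := memLp_fourierInv H hI h2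
  have hcont : Continuous (𝓕⁻ H) := by
    have := VectorFourier.fourierIntegral_continuous Real.continuous_fourierChar
      (L := -(innerₗ (Eucl n)))
      (by simp only [LinearMap.neg_apply, innerₗ_apply_apply]; fun_prop) hI
    exact this
  have hle : ∀ x, ‖fracLap s η x‖ ≤ ‖𝓕⁻ H x‖ := fun x => Complex.abs_re_le_norm _
  have hc' : Continuous (fracLap s η) := Complex.continuous_re.comp hcont
  refine ⟨hc', fun a ha => ?_⟩
  have hf2 : MemLp (fracLap s η) 2 volume :=
    hF2.mono hc'.aestronglyMeasurable (ae_of_all _ hle)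
  set D : ℝ≥0∞ := ENNReal.ofReal (∫ v, ‖H v‖) with hD
  have hbd : ∀ x, ‖fracLap s η x‖ₑ ≤ D := by
    intro x
    rw [← ofReal_norm]
    apply ENNReal.ofReal_le_ofReal
    refine (hle x).trans ?_
    exact VectorFourier.norm_fourierIntegral_le_integral_norm 𝐞 volume (-(innerₗ (Eucl n))) H x
  have h2' := hf2.eLpNorm_lt_top
  rw [eLpNorm_lt_top_iff_lintegral_rpow_enorm_lt_top (by norm_num) (by norm_num)] at h2'
  calc ∫⁻ x, ‖fracLap s η x‖ₑ ^ a ≤ ∫⁻ x, D ^ (a - 2) * ‖fracLap s η x‖ₑ ^ (2:ℝ) := by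
        refine lintegral_mono fun x => ?_
        calc ‖fracLap s η x‖ₑ ^ a = ‖fracLap s η x‖ₑ ^ ((a-2) + 2) := by congr 1; ring
          _ = ‖fracLap s η x‖ₑ ^ (a-2) * ‖fracLap s η x‖ₑ ^ (2:ℝ) :=
            ENNReal.rpow_add_of_nonneg _ _ (by linarith) (by norm_num)
          _ ≤ _ := by
            gcongr
            exact hbd x
    _ = D ^ (a - 2) * ∫⁻ x, ‖fracLap s η x‖ₑ ^ (2:ℝ) :=
        lintegral_const_mul' _ _ (ENNReal.rpow_ne_top_of_nonneg (by linarith) ENNReal.ofReal_ne_top)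
    _ < ∞ := by
        refine ENNReal.mul_lt_top (ENNReal.rpow_lt_top_of_nonneg (by linarith) ENNReal.ofReal_ne_top) ?_
        simpa using h2'

theorem young_aux {n : ℕ} {k f : Eucl n → ℝ≥0∞} (hk : Measurable k) (hf : Measurable f)
    {c s b : ℝ} (hc : 0 < c) (hs : 0 < s) (hb : 0 < b) (hcb : c ≤ b) (hsb : s ≤ b)
    (h : 1 / c + 1 / s = 1 + 1 / b) :
    ∫⁻ x, (∫⁻ y, k (x - y) * f y) ^ b ≤ (∫⁻ x, k x ^ c) ^ (b / c) * (∫⁻ x, f x ^ s) ^ (b / s) := by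
  set Kc := ∫⁻ x, k x ^ c with hKc
  set Ms := ∫⁻ x, f x ^ s with hMs
  have hcb' : 1 / b ≤ 1 / c := one_div_le_one_div_of_le hc hcb
  have hsb' : 1 / b ≤ 1 / s := one_div_le_one_div_of_le hs hsb
  have hb0 : 0 < 1 / b := by positivity
  have hpt : ∀ x y : Eucl n, k (x - y) * f y =
      (k (x - y) ^ c * f y ^ s) ^ (1 / b) * (k (x - y) ^ c) ^ (1 / c - 1 / b)
        * (f y ^ s) ^ (1 / s - 1 / b) := by
    intro x y
    rw [ENNReal.mul_rpow_of_nonneg _ _ hb0.le]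
    have e1 : k (x - y) = (k (x - y) ^ c) ^ (1 / b) * (k (x - y) ^ c) ^ (1 / c - 1 / b) := by
      rw [← ENNReal.rpow_add_of_nonneg _ _ hb0.le (by linarith), ← ENNReal.rpow_mul]
      have : c * (1 / b + (1 / c - 1 / b)) = 1 := by field_simp; ring
      rw [this, ENNReal.rpow_one]
    have e2 : f y = (f y ^ s) ^ (1 / b) * (f y ^ s) ^ (1 / s - 1 / b) := by
      rw [← ENNReal.rpow_add_of_nonneg _ _ hb0.le (by linarith), ← ENNReal.rpow_mul]
      have : s * (1 / b + (1 / s - 1 / b)) = 1 := by field_simp; ring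
      rw [this, ENNReal.rpow_one]
    conv_lhs => rw [e1, e2]
    ring
  set A : Eucl n → ℝ≥0∞ := fun x => ∫⁻ y, k (x - y) ^ c * f y ^ s with hA
  have hmA2 : Measurable (fun z : Eucl n × Eucl n => k (z.1 - z.2) ^ c * f z.2 ^ s) := by fun_prop
  have hmA : Measurable A := hmA2.lintegral_prod_right'
  have hin : ∀ x : Eucl n, (∫⁻ y, k (x - y) * f y) ≤
      A x ^ (1 / b) * Kc ^ (1 / c - 1 / b) * Ms ^ (1 / s - 1 / b) := by
    intro x
    have := ENNReal.lintegral_prod_norm_pow_le (μ := (volume : Measure (Eucl n))) (Finset.univ : Finset (Fin 3))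
      (f := ![fun y => k (x - y) ^ c * f y ^ s, fun y => k (x - y) ^ c, fun y => f y ^ s])
      (p := ![1 / b, 1 / c - 1 / b, 1 / s - 1 / b])
      (by
        intro i _
        fin_cases i
        · simp; fun_prop
        · simp; fun_prop
        · simp; fun_prop)
      (by simp only [Fin.sum_univ_three, Matrix.cons_val]; linarith)
      (by
        intro i _
        fin_cases i
        · simp only [Fin.zero_eta, Matrix.cons_val]; linarith
        · simp only [Fin.mk_one, Matrix.cons_val]; linarith
        · simp only [Fin.reduceFinMk, Matrix.cons_val]; linarith)
    simp only [Fin.prod_univ_three, Matrix.cons_val] at this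
    rw [lintegral_sub_left_eq_self (fun y => k y ^ c) x] at this
    calc (∫⁻ y, k (x - y) * f y) = _ := lintegral_congr (hpt x)
      _ ≤ _ := this
  have hin2 : ∀ x : Eucl n, (∫⁻ y, k (x - y) * f y) ^ b ≤
      A x * (Kc ^ (b / c - 1) * Ms ^ (b / s - 1)) := by
    intro x
    calc _ ≤ (A x ^ (1 / b) * Kc ^ (1 / c - 1 / b) * Ms ^ (1 / s - 1 / b)) ^ b := by
          gcongr; exact hin x
      _ = _ := by
        rw [ENNReal.mul_rpow_of_nonneg _ _ hb.le, ENNReal.mul_rpow_of_nonneg _ _ hb.le,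
          ← ENNReal.rpow_mul, ← ENNReal.rpow_mul, ← ENNReal.rpow_mul]
        have e0 : 1 / b * b = 1 := by field_simp
        have e1 : (1 / c - 1 / b) * b = b / c - 1 := by field_simp
        have e2 : (1 / s - 1 / b) * b = b / s - 1 := by field_simp
        rw [e0, e1, e2, ENNReal.rpow_one, mul_assoc]
  have hAint : ∫⁻ x, A x = Kc * Ms := by
    rw [hA]
    rw [lintegral_lintegral_swap hmA2.aemeasurable]
    calc ∫⁻ y, ∫⁻ x, k (x - y) ^ c * f y ^ s = ∫⁻ y, Kc * f y ^ s := by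
          refine lintegral_congr fun y => ?_
          rw [lintegral_mul_const _ (by fun_prop), lintegral_sub_right_eq_self (fun x => k x ^ c) y]
      _ = Kc * Ms := by rw [lintegral_const_mul _ (by fun_prop)]
  have hbc : 0 ≤ b / c - 1 := by rw [sub_nonneg, one_le_div hc]; exact hcb
  have hbs : 0 ≤ b / s - 1 := by rw [sub_nonneg, one_le_div hs]; exact hsb
  calc _ ≤ ∫⁻ x, A x * (Kc ^ (b / c - 1) * Ms ^ (b / s - 1)) := lintegral_mono hin2
    _ = (Kc * Ms) * (Kc ^ (b / c - 1) * Ms ^ (b / s - 1)) := by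
      rw [lintegral_mul_const _ hmA, hAint]
    _ = (Kc ^ (1:ℝ) * Kc ^ (b / c - 1)) * (Ms ^ (1:ℝ) * Ms ^ (b / s - 1)) := by
      rw [ENNReal.rpow_one, ENNReal.rpow_one]; ring
    _ = _ := by
      rw [← ENNReal.rpow_add_of_nonneg _ _ (by norm_num) hbc,
        ← ENNReal.rpow_add_of_nonneg _ _ (by norm_num) hbs]
      congr 2 <;> ring

theorem lintegral_Ioc_rpow_aux {T α : ℝ} (hT : 0 < T) (hα : 0 < α) :
    ∫⁻ t in Ioc 0 T, ENNReal.ofReal (t ^ (α - 1)) = ENNReal.ofReal (T ^ α / α) := by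
  have hi : IntegrableOn (fun t : ℝ => t ^ (α - 1)) (Ioc 0 T) := by
    have := (intervalIntegral.intervalIntegrable_rpow' (a := 0) (b := T) (r := α - 1) (by linarith))
    rwa [intervalIntegrable_iff_integrableOn_Ioc_of_le hT.le] at this
  rw [← ofReal_integral_eq_lintegral_ofReal hi]
  · rw [← intervalIntegral.integral_of_le hT.le, integral_rpow (Or.inl (by linarith))]
    congr 1
    rw [sub_add_cancel, Real.zero_rpow hα.ne', sub_zero]
  · filter_upwards [ae_restrict_mem measurableSet_Ioc] with t ht
    exact Real.rpow_nonneg ht.1.le _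

theorem lintegral_Ioi_rpow_aux {T β : ℝ} (hT : 0 < T) (hβ : 0 < β) :
    ∫⁻ t in Ioi T, ENNReal.ofReal (t ^ (-β - 1)) = ENNReal.ofReal (T ^ (-β) / β) := by
  have hi : IntegrableOn (fun t : ℝ => t ^ (-β - 1)) (Ioi T) :=
    integrableOn_Ioi_rpow_of_lt (by linarith) hT
  rw [← ofReal_integral_eq_lintegral_ofReal hi]
  · rw [integral_Ioi_rpow_of_lt (by linarith) hT]
    congr 1
    rw [sub_add_cancel, neg_div_neg_eq]
  · filter_upwards [ae_restrict_mem measurableSet_Ioi] with t ht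
    exact Real.rpow_nonneg (hT.le.trans (le_of_lt ht)) _

theorem weak_to_strong {n : ℕ} (p s : ℝ) (hs : 0 < s) (hsp : s < p) :
    ∃ K : ℝ, 0 < K ∧ ∀ (f : Eucl n → ℝ) (N : ℝ), Measurable f → 0 < N →
      (∀ x, x ∉ ball (0 : Eucl n) 1 → f x = 0) →
      (∀ l : ℝ, 0 < l → volume {x | l < |f x|} ≤ ENNReal.ofReal ((N / l) ^ p)) →
      ∫⁻ x, ‖f x‖ₑ ^ s ≤ ENNReal.ofReal (K * N ^ s) := by
  set V := (volume (ball (0 : Eucl n) 1)).toReal with hV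
  have hVe : ENNReal.ofReal V = volume (ball (0 : Eucl n) 1) :=
    ENNReal.ofReal_toReal measure_ball_lt_top.ne
  have hV0 : 0 ≤ V := ENNReal.toReal_nonneg
  have hps : 0 < p - s := by linarith
  refine ⟨s * (V / s + 1 / (p - s)), by positivity, ?_⟩
  intro f N hf hN hsupp hw
  have h0 : ∫⁻ x, ‖f x‖ₑ ^ s = ∫⁻ x, ENNReal.ofReal (|f x| ^ s) := by
    refine lintegral_congr fun x => ?_
    rw [← ofReal_norm, ENNReal.ofReal_rpow_of_nonneg (norm_nonneg _) hs.le, Real.norm_eq_abs]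
  rw [h0, lintegral_rpow_eq_lintegral_meas_lt_mul volume (ae_of_all _ fun x => abs_nonneg _)
    (by fun_prop) hs, mul_assoc, ENNReal.ofReal_mul hs.le]
  gcongr
  rw [← Ioc_union_Ioi_eq_Ioi hN.le, lintegral_union measurableSet_Ioi (Ioc_disjoint_Ioi le_rfl)]
  have a1 : ∫⁻ t in Ioc 0 N, volume {a | t < |f a|} * ENNReal.ofReal (t ^ (s - 1)) ≤
      ENNReal.ofReal (V / s * N ^ s) := by
    calc _ ≤ ∫⁻ t in Ioc 0 N, ENNReal.ofReal V * ENNReal.ofReal (t ^ (s - 1)) := by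
          refine setLIntegral_mono' measurableSet_Ioc fun t ht => ?_
          gcongr
          rw [hVe]
          refine measure_mono fun x hx => ?_
          by_contra hxb
          have := hsupp x hxb
          simp only [mem_ofPred_eq, this, abs_zero] at hx
          linarith [ht.1]
      _ = _ := by
        rw [lintegral_const_mul' _ _ ENNReal.ofReal_ne_top, lintegral_Ioc_rpow_aux hN hs,
          ← ENNReal.ofReal_mul hV0]
        congr 1; ring
  have a2 : ∫⁻ t in Ioi N, volume {a | t < |f a|} * ENNReal.ofReal (t ^ (s - 1)) ≤
      ENNReal.ofReal (1 / (p - s) * N ^ s) := by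
    calc _ ≤ ∫⁻ t in Ioi N, ENNReal.ofReal (N ^ p) * ENNReal.ofReal (t ^ (-(p - s) - 1)) := by
          refine setLIntegral_mono' measurableSet_Ioi fun t ht => ?_
          have ht0 : 0 < t := hN.trans ht
          calc _ ≤ ENNReal.ofReal ((N / t) ^ p) * ENNReal.ofReal (t ^ (s - 1)) := by
                gcongr; exact hw t ht0
            _ = _ := by
              rw [← ENNReal.ofReal_mul (by positivity), ← ENNReal.ofReal_mul (by positivity)]
              congr 1
              rw [Real.div_rpow hN.le ht0.le, div_eq_mul_inv, ← Real.rpow_neg ht0.le, mul_assoc,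
                ← Real.rpow_add ht0]
              congr 2; ring
      _ = _ := by
        rw [lintegral_const_mul' _ _ ENNReal.ofReal_ne_top, lintegral_Ioi_rpow_aux hN hps,
          ← ENNReal.ofReal_mul (by positivity)]
        congr 1
        have : N ^ s = N ^ p * N ^ (-(p - s)) := by rw [← Real.rpow_add hN]; congr 1; ring
        rw [this]; ring
  calc _ ≤ _ := add_le_add a1 a2
    _ = _ := by
      rw [← ENNReal.ofReal_add (by positivity) (by positivity)]
      congr 1; ring

theorem kernel_near {n : ℕ} (hn : 1 ≤ n) {c : ℝ} (hc0 : 0 < c) (hc : c < 2) :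
    ∫⁻ x : Eucl n, ((ball (0 : Eucl n) 1).indicator
      (fun z => ENNReal.ofReal (‖z‖ ^ (-((n:ℝ)/2)))) x) ^ c < ∞ := by
  have hn' : (0:ℝ) < n := by exact_mod_cast hn
  have hi : IntegrableOn (fun z : Eucl n => ‖z‖ ^ (-((n:ℝ)/2 * c))) (ball 0 1) volume := by
    refine integrableOn_ball_of_norm_le_rpow (C := 1) (α := (n:ℝ)/2 * c) (by simpa using hn) ?_ ?_ ?_
    · simp only [finrank_euclideanSpace, Fintype.card_fin]; nlinarith
    · refine ae_of_all _ fun x => ?_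
      rw [one_mul, Real.norm_of_nonneg (by positivity)]
    · exact (by fun_prop : Measurable (fun z : Eucl n => ‖z‖ ^ (-((n:ℝ)/2 * c)))).aestronglyMeasurable
  have h1 : ∀ x : Eucl n, ((ball (0 : Eucl n) 1).indicator
      (fun z => ENNReal.ofReal (‖z‖ ^ (-((n:ℝ)/2)))) x) ^ c =
      (ball (0 : Eucl n) 1).indicator (fun z => ‖‖z‖ ^ (-((n:ℝ)/2 * c))‖ₑ) x := by
    intro x
    by_cases hx : x ∈ ball (0 : Eucl n) 1
    · rw [indicator_of_mem hx, indicator_of_mem hx, ENNReal.ofReal_rpow_of_nonneg (by positivity) hc0.le,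
        Real.enorm_of_nonneg (by positivity), ← Real.rpow_mul (norm_nonneg _)]
      congr 2; ring
    · rw [indicator_of_notMem hx, indicator_of_notMem hx, ENNReal.zero_rpow_of_pos hc0]
  rw [lintegral_congr h1, lintegral_indicator measurableSet_ball]
  exact hi.2

theorem kernel_far {n : ℕ} (hn : 1 ≤ n) {c : ℝ} (hc : 2 < c) :
    ∫⁻ x : Eucl n, ((ball (0 : Eucl n) 1)ᶜ.indicator
      (fun z => ENNReal.ofReal (‖z‖ ^ (-((n:ℝ)/2)))) x) ^ c < ∞ := by
  have hn' : (0:ℝ) < n := by exact_mod_cast hn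
  have hi := integrable_one_add_norm (E := Eucl n) (μ := volume) (r := (n:ℝ)/2 * c)
    (by simp only [finrank_euclideanSpace, Fintype.card_fin]; nlinarith)
  have hi2 := (hi.const_mul ((2:ℝ) ^ ((n:ℝ)/2 * c)))
  have h1 : ∀ x : Eucl n, ((ball (0 : Eucl n) 1)ᶜ.indicator
      (fun z => ENNReal.ofReal (‖z‖ ^ (-((n:ℝ)/2)))) x) ^ c ≤
      ‖(2:ℝ) ^ ((n:ℝ)/2 * c) * (1 + ‖x‖) ^ (-((n:ℝ)/2 * c))‖ₑ := by
    intro x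
    by_cases hx : x ∈ ball (0 : Eucl n) 1
    · rw [indicator_of_notMem (by simpa using hx), ENNReal.zero_rpow_of_pos (by linarith)]
      exact zero_le
    · rw [indicator_of_mem (by simpa using hx), ENNReal.ofReal_rpow_of_nonneg (by positivity) (by linarith),
        Real.enorm_of_nonneg (by positivity), ← Real.rpow_mul (norm_nonneg _)]
      apply ENNReal.ofReal_le_ofReal
      have hx1 : 1 ≤ ‖x‖ := by simpa using hx
      rw [Real.rpow_neg (by positivity), ← Real.inv_rpow (by positivity), ← Real.mul_rpow (by norm_num) (by positivity),
        neg_mul, Real.rpow_neg (by positivity), ← Real.inv_rpow (by positivity)]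
      apply Real.rpow_le_rpow (by positivity) _ (by positivity)
      rw [← div_eq_mul_inv, ← one_div, div_le_div_iff₀ (by linarith) (by linarith)]
      linarith
  exact (lintegral_mono h1).trans_lt hi2.2

def Upot {n : ℕ} (f : Eucl n → ℝ) (x : Eucl n) : ℝ≥0∞ :=
  ∫⁻ y, ENNReal.ofReal (‖x - y‖ ^ (-((n:ℝ)/2))) * ‖f y‖ₑ

theorem measurable_Upot {n : ℕ} (f : Eucl n → ℝ) (hf : Measurable f) : Measurable (Upot f) := by
  have : Measurable (fun z : Eucl n × Eucl n =>
      ENNReal.ofReal (‖z.1 - z.2‖ ^ (-((n:ℝ)/2))) * ‖f z.2‖ₑ) := by fun_prop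
  exact this.lintegral_prod_right'

theorem Upot_bound {n : ℕ} (hn : 1 ≤ n) (p b : ℝ) (hp : 1 < p) (hb : 2 < b)
    (hpb : 1 / p - 1 / 2 < 1 / b) :
    ∃ K : ℝ, 0 < K ∧ ∀ (f : Eucl n → ℝ) (N : ℝ), Measurable f → 0 < N →
      (∀ x, x ∉ ball (0 : Eucl n) 1 → f x = 0) →
      (∀ l : ℝ, 0 < l → volume {x | l < |f x|} ≤ ENNReal.ofReal ((N / l) ^ p)) →
      ∫⁻ x, Upot f x ^ b ≤ ENNReal.ofReal (K * N ^ b) := by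
  have hb0 : 0 < b := by linarith
  have hib : 0 < 1 / b := by positivity
  have hib2 : 1 / b < 1 / 2 := one_div_lt_one_div_of_lt (by norm_num) hb
  have hip : 0 < 1 / p := by positivity
  have hip1 : 1 / p < 1 := by rw [div_lt_one (by linarith)]; exact hp
  obtain ⟨κ, hκ1, hκ2⟩ : ∃ κ : ℝ, 1 / 2 < κ ∧ κ < min 1 (1 + 1 / b - 1 / p) := by
    apply exists_between
    rw [lt_min_iff]; constructor
    · norm_num
    · linarith
  have hκ3 : κ < 1 := hκ2.trans_le (min_le_left _ _)
  have hκ4 : κ < 1 + 1 / b - 1 / p := hκ2.trans_le (min_le_right _ _)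
  set σ := 1 + 1 / b - κ with hσ
  have hσ1 : 1 / p < σ := by linarith
  have hσb : 1 / b < σ := by linarith
  have hc0 : 0 < 1 / κ := by apply one_div_pos.2; linarith
  have hs0 : 0 < 1 / σ := by apply one_div_pos.2; linarith
  have hc2 : 1 / κ < 2 := by rw [div_lt_iff₀ (by linarith)]; linarith
  have hcb : 1 / κ ≤ b := by linarith
  have hsb : 1 / σ ≤ b := by rw [div_le_iff₀ (by linarith)]; rw [div_lt_iff₀ hb0] at hσb; linarith
  have hsp : 1 / σ < p := by
    rw [div_lt_iff₀ (by linarith)]; rw [div_lt_iff₀ (by linarith)] at hσ1; linarith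
  have hexp : 1 / (1 / κ) + 1 / (1 / σ) = 1 + 1 / b := by rw [one_div_one_div, one_div_one_div]; linarith
  obtain ⟨K1, hK1, H1⟩ := weak_to_strong (n := n) p (1 / σ) hs0 hsp
  obtain ⟨K2, hK2, H2⟩ := weak_to_strong (n := n) p 1 one_pos hp
  set k1 : Eucl n → ℝ≥0∞ := (ball (0 : Eucl n) 1).indicator
      (fun z => ENNReal.ofReal (‖z‖ ^ (-((n:ℝ)/2)))) with hk1
  set k2 : Eucl n → ℝ≥0∞ := (ball (0 : Eucl n) 1)ᶜ.indicator
      (fun z => ENNReal.ofReal (‖z‖ ^ (-((n:ℝ)/2)))) with hk2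
  have mk1 : Measurable k1 := Measurable.indicator (by fun_prop) measurableSet_ball
  have mk2 : Measurable k2 := Measurable.indicator (by fun_prop) measurableSet_ball.compl
  have F1 := kernel_near hn hc0 hc2
  have F2 := kernel_far hn hb
  rw [← hk1] at F1
  rw [← hk2] at F2
  set A1 := (∫⁻ x, k1 x ^ (1 / κ)) with hA1
  set A2 := (∫⁻ x, k2 x ^ b) with hA2
  set D : ℝ≥0∞ := 2 ^ (b - 1) * (A1 ^ (b / (1 / κ)) * ENNReal.ofReal K1 ^ (b / (1/σ)) +
     A2 ^ (b / b) * ENNReal.ofReal K2 ^ (b / 1)) with hD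
  have hDt : D ≠ ∞ := by
    have e1 : A1 ^ (b / (1 / κ)) ≠ ∞ := ENNReal.rpow_ne_top_of_nonneg (by positivity) F1.ne
    have e2 : A2 ^ (b / b) ≠ ∞ := ENNReal.rpow_ne_top_of_nonneg (by positivity) F2.ne
    have e3 : ENNReal.ofReal K1 ^ (b / (1/σ)) ≠ ∞ :=
      ENNReal.rpow_ne_top_of_nonneg (by positivity) ENNReal.ofReal_ne_top
    have e4 : ENNReal.ofReal K2 ^ (b / 1) ≠ ∞ :=
      ENNReal.rpow_ne_top_of_nonneg (by positivity) ENNReal.ofReal_ne_top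
    have e5 : (2:ℝ≥0∞) ^ (b - 1) ≠ ∞ := ENNReal.rpow_ne_top_of_nonneg (by linarith) (by norm_num)
    exact ENNReal.mul_ne_top e5 (ENNReal.add_ne_top.2 ⟨ENNReal.mul_ne_top e1 e3, ENNReal.mul_ne_top e2 e4⟩)
  refine ⟨D.toReal + 1, by positivity, ?_⟩
  intro f N hf hN hsupp hw
  have G1 := H1 f N hf hN hsupp hw
  have G2 := H2 f N hf hN hsupp hw
  have hU : ∀ x, Upot f x = (∫⁻ y, k1 (x - y) * ‖f y‖ₑ) + ∫⁻ y, k2 (x - y) * ‖f y‖ₑ := by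
    intro x
    rw [← lintegral_add_left (by fun_prop)]
    refine lintegral_congr fun y => ?_
    rw [← add_mul]
    congr 1
    have := congrFun (indicator_self_add_compl (ball (0 : Eucl n) 1) (fun z => ENNReal.ofReal (‖z‖ ^ (-((n:ℝ)/2))))) (x - y)
    exact this.symm
  have mfe : Measurable (fun y => ‖f y‖ₑ) := by fun_prop
  have Y1 := young_aux mk1 mfe hc0 hs0 hb0 hcb hsb hexp
  have Y2 := young_aux mk2 mfe hb0 one_pos hb0 le_rfl (by linarith) (by ring)
  rw [← hA1] at Y1
  rw [← hA2] at Y2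
  have scal : ∀ K s : ℝ, 0 < K → 0 < s → ENNReal.ofReal (K * N ^ s) ^ (b / s) =
      ENNReal.ofReal K ^ (b / s) * ENNReal.ofReal (N ^ b) := by
    intro K s hK hs
    rw [ENNReal.ofReal_mul hK.le, ENNReal.mul_rpow_of_nonneg _ _ (by positivity)]
    congr 1
    rw [ENNReal.ofReal_rpow_of_nonneg (by positivity) (by positivity), ← Real.rpow_mul hN.le]
    congr 2; field_simp
  have mU1 : Measurable (fun x => ∫⁻ y, k1 (x - y) * ‖f y‖ₑ) := by
    have : Measurable (fun z : Eucl n × Eucl n => k1 (z.1 - z.2) * ‖f z.2‖ₑ) := by fun_prop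
    exact this.lintegral_prod_right'
  calc ∫⁻ x, Upot f x ^ b ≤ ∫⁻ x, 2 ^ (b - 1) * ((∫⁻ y, k1 (x - y) * ‖f y‖ₑ) ^ b
          + (∫⁻ y, k2 (x - y) * ‖f y‖ₑ) ^ b) := by
        refine lintegral_mono fun x => ?_
        rw [hU]
        exact ENNReal.rpow_add_le_mul_rpow_add_rpow _ _ (by linarith)
    _ = 2 ^ (b - 1) * ((∫⁻ x, (∫⁻ y, k1 (x - y) * ‖f y‖ₑ) ^ b)
          + ∫⁻ x, (∫⁻ y, k2 (x - y) * ‖f y‖ₑ) ^ b) := by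
        rw [lintegral_const_mul' _ _ (ENNReal.rpow_ne_top_of_nonneg (by linarith) (by norm_num)),
          lintegral_add_left (mU1.pow_const _)]
    _ ≤ 2 ^ (b - 1) * ((A1 ^ (b / (1 / κ)) * ENNReal.ofReal (K1 * N ^ (1 / σ)) ^ (b / (1 / σ))) +
          A2 ^ (b / b) * ENNReal.ofReal (K2 * N ^ (1:ℝ)) ^ (b / 1)) := by
        gcongr
        · refine Y1.trans ?_
          gcongr
        · refine Y2.trans ?_
          gcongr
    _ = D * ENNReal.ofReal (N ^ b) := by
        rw [scal _ _ hK1 hs0, scal _ _ hK2 one_pos, hD]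
        ring
    _ ≤ ENNReal.ofReal (D.toReal + 1) * ENNReal.ofReal (N ^ b) := by
        gcongr
        rw [← ENNReal.ofReal_toReal hDt]
        apply ENNReal.ofReal_le_ofReal
        rw [ENNReal.toReal_ofReal ENNReal.toReal_nonneg]
        linarith
    _ = _ := by rw [← ENNReal.ofReal_mul (by positivity)]

theorem lintegral_scale {n : ℕ} (f : Eucl n → ℝ≥0∞) (hf : Measurable f) (x₀ : Eucl n) (r : ℝ)
    (hr : 0 < r) : ∫⁻ x, f (r⁻¹ • (x - x₀)) = ENNReal.ofReal (r ^ n) * ∫⁻ x, f x := by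
  rw [lintegral_sub_right_eq_self (fun x => f (r⁻¹ • x)) x₀]
  have h := Measure.map_addHaar_smul (volume : Measure (Eucl n)) (inv_ne_zero hr.ne')
  have h2 : ∫⁻ x, f (r⁻¹ • x) = ∫⁻ y, f y ∂(Measure.map (fun x : Eucl n => r⁻¹ • x) volume) := by
    rw [lintegral_map hf (by fun_prop)]
  rw [h2]
  have h3 : Measure.map (fun x : Eucl n => r⁻¹ • x) volume = Measure.map (r⁻¹ • ·) (volume : Measure (Eucl n)) := rfl
  rw [h3, h, lintegral_smul_measure]
  simp only [finrank_euclideanSpace, Fintype.card_fin, inv_pow, inv_inv, smul_eq_mul]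
  rw [abs_of_pos (by positivity)]

theorem enorm_rieszPot_le {n : ℕ} (f : Eucl n → ℝ) (x : Eucl n) :
    ‖rieszPot ((n:ℝ)/2) f x‖ₑ ≤ ‖rieszConst n ((n:ℝ)/2)‖ₑ * Upot f x := by
  unfold rieszPot Upot
  rw [enorm_mul]
  gcongr
  refine (enorm_integral_le_lintegral_enorm _).trans ?_
  refine lintegral_mono fun y => ?_
  rw [enorm_mul, Real.enorm_of_nonneg (by positivity)]
  have : (n:ℝ)/2 - n = -((n:ℝ)/2) := by ring
  rw [this]

theorem unit_bound {n : ℕ} (hn : 1 ≤ n) (p P : ℝ) (hp : 1 < p) (hP : 1 < P)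
    (hpP : 1 / p - 1 / 2 < 1 / P) (G : Eucl n → ℝ) (hGm : Measurable G)
    (hG : ∀ a : ℝ, 2 ≤ a → ∫⁻ x, ‖G x‖ₑ ^ a < ∞) (R : ℝ≥0∞) (hR : R ≠ ∞) :
    ∃ C : ℝ, 0 < C ∧ ∃ γ : ℝ, 0 < γ ∧ ∀ (Λ : ℝ) (f : Eucl n → ℝ) (N : ℝ), 1 ≤ Λ → Measurable f → 0 < N →
      (∀ x, x ∉ ball (0 : Eucl n) 1 → f x = 0) →
      (∀ l : ℝ, 0 < l → volume {x | l < |f x|} ≤ ENNReal.ofReal ((N / l) ^ p)) →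
      ∫⁻ x, (ENNReal.ofReal (Λ ^ (-((n:ℝ)/2))) * ‖G (Λ⁻¹ • x)‖ₑ * (R * Upot f x)) ^ P ≤
        ENNReal.ofReal ((C * Λ ^ (-γ) * N) ^ P) := by
  have hn' : (0:ℝ) < n := by exact_mod_cast hn
  have hP0 : 0 < P := by linarith
  have hip : 0 < 1 / p := by positivity
  have hip1 : 1 / p < 1 := by rw [div_lt_one (by linarith)]; exact hp
  have hiP : 0 < 1 / P := by positivity
  have hiP1 : 1 / P < 1 := by rw [div_lt_one (by linarith)]; exact hP
  obtain ⟨β, hβ1, hβ2⟩ : ∃ β : ℝ, max 0 (max (1 / P - 1 / 2) (1 / p - 1 / 2)) < β ∧ β < min (1 / 2) (1 / P) := by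
    apply exists_between
    simp only [lt_min_iff, max_lt_iff]
    refine ⟨⟨by norm_num, by linarith, by linarith⟩, by linarith, by linarith, by linarith⟩
  simp only [lt_min_iff, max_lt_iff] at hβ1 hβ2
  obtain ⟨hβ0, hβP, hβp⟩ := hβ1
  obtain ⟨hβh, hβP'⟩ := hβ2
  set α := 1 / P - β with hα
  have hα0 : 0 < α := by linarith
  have hαh : α < 1 / 2 := by linarith
  have hb : 2 < 1 / β := by rw [lt_div_iff₀ hβ0]; linarith
  have ha : 2 < 1 / α := by rw [lt_div_iff₀ hα0]; linarith
  obtain ⟨K, hK, HK⟩ := Upot_bound hn p (1 / β) hp hb (by rw [one_div_one_div]; exact hβp)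
  have hI := hG (1 / α) ha.le
  set I := ∫⁻ x, ‖G x‖ₑ ^ (1 / α) with hIdef
  have hPab : P * α + P * β = 1 := by rw [hα]; field_simp; ring
  set D : ℝ≥0∞ := R ^ P * (I ^ (P * α) * ENNReal.ofReal K ^ (P * β)) with hD
  have hDt : D ≠ ∞ := by
    refine ENNReal.mul_ne_top (ENNReal.rpow_ne_top_of_nonneg (by positivity) hR) (ENNReal.mul_ne_top ?_ ?_)
    · exact ENNReal.rpow_ne_top_of_nonneg (by positivity) hI.ne
    · exact ENNReal.rpow_ne_top_of_nonneg (by positivity) ENNReal.ofReal_ne_top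
  refine ⟨(D.toReal + 1) ^ (1 / P), by positivity, n * (1 / 2 - α), mul_pos hn' (by linarith), ?_⟩
  intro Λ f N hΛ hf hN hsupp hw
  have hΛ0 : 0 < Λ := by linarith
  have hU := HK f N hf hN hsupp hw
  have mU := measurable_Upot f hf
  set g : Eucl n → ℝ≥0∞ := fun x => ENNReal.ofReal (Λ ^ (-((n:ℝ)/2))) * ‖G (Λ⁻¹ • x)‖ₑ with hg
  have mg : Measurable g := by
    have : Measurable (fun x : Eucl n => G (Λ⁻¹ • x)) := hGm.comp (by fun_prop)
    fun_prop
  have hgI : ∫⁻ x, g x ^ (1 / α) = ENNReal.ofReal (Λ ^ (n - (n:ℝ)/2 * (1 / α))) * I := by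
    have h1 := lintegral_scale (fun x => ‖G x‖ₑ ^ (1 / α)) (by fun_prop) 0 Λ hΛ0
    simp only [sub_zero] at h1
    calc ∫⁻ x, g x ^ (1 / α) = ∫⁻ x, ENNReal.ofReal (Λ ^ (-((n:ℝ)/2))) ^ (1 / α) * ‖G (Λ⁻¹ • x)‖ₑ ^ (1 / α) := by
          refine lintegral_congr fun x => ?_
          rw [hg]; simp only
          rw [ENNReal.mul_rpow_of_nonneg _ _ (by positivity)]
      _ = ENNReal.ofReal (Λ ^ (-((n:ℝ)/2))) ^ (1 / α) * (ENNReal.ofReal (Λ ^ n) * I) := by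
          rw [lintegral_const_mul' _ _ (ENNReal.rpow_ne_top_of_nonneg (by positivity) ENNReal.ofReal_ne_top), h1]
      _ = _ := by
          rw [ENNReal.ofReal_rpow_of_nonneg (by positivity) (by positivity), ← mul_assoc,
            ← ENNReal.ofReal_mul (by positivity), ← Real.rpow_mul hΛ0.le, ← Real.rpow_natCast, ← Real.rpow_add hΛ0]
          congr 3; ring
  have hgoal : ∀ x, ENNReal.ofReal (Λ ^ (-((n:ℝ)/2))) * ‖G (Λ⁻¹ • x)‖ₑ = g x := fun x => rfl
  simp only [hgoal]
  clear_value g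
  calc ∫⁻ x, (g x * (R * Upot f x)) ^ P
      = ∫⁻ x, R ^ P * ((g x ^ (1 / α)) ^ (P * α) * (Upot f x ^ (1 / β)) ^ (P * β)) := by
        refine lintegral_congr fun x => ?_
        rw [← ENNReal.rpow_mul, ← ENNReal.rpow_mul,
          ENNReal.mul_rpow_of_nonneg (g x) (R * Upot f x) hP0.le,
          ENNReal.mul_rpow_of_nonneg R (Upot f x) hP0.le]
        have e1 : 1 / α * (P * α) = P := by field_simp
        have e2 : 1 / β * (P * β) = P := by field_simp
        rw [e1, e2]; ring
    _ = R ^ P * ∫⁻ x, ((g x ^ (1 / α)) ^ (P * α) * (Upot f x ^ (1 / β)) ^ (P * β)) :=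
        lintegral_const_mul' _ _ (ENNReal.rpow_ne_top_of_nonneg (by positivity) hR)
    _ ≤ R ^ P * ((∫⁻ x, g x ^ (1 / α)) ^ (P * α) * (∫⁻ x, Upot f x ^ (1 / β)) ^ (P * β)) := by
        gcongr
        exact ENNReal.lintegral_mul_norm_pow_le (mg.pow_const _).aemeasurable
          (mU.pow_const _).aemeasurable (by positivity) (by positivity) hPab
    _ ≤ R ^ P * ((ENNReal.ofReal (Λ ^ (n - (n:ℝ)/2 * (1 / α))) * I) ^ (P * α) *
          (ENNReal.ofReal (K * N ^ (1 / β))) ^ (P * β)) := by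
        rw [hgI]
        gcongr
    _ = D * ENNReal.ofReal ((Λ ^ (-(n * (1 / 2 - α))) * N) ^ P) := by
        rw [ENNReal.ofReal_mul hK.le, ENNReal.mul_rpow_of_nonneg _ _ (by positivity),
          ENNReal.mul_rpow_of_nonneg _ _ (by positivity), Real.mul_rpow (by positivity) hN.le,
          ENNReal.ofReal_mul (by positivity),
          ENNReal.ofReal_rpow_of_nonneg (by positivity) (by positivity),
          ENNReal.ofReal_rpow_of_nonneg (x := N ^ (1 / β)) (by positivity) (by positivity), ← Real.rpow_mul hΛ0.le,
          ← Real.rpow_mul hN.le, ← Real.rpow_mul hΛ0.le]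
        have e1 : (n - (n:ℝ)/2 * (1 / α)) * (P * α) = -(n * (1 / 2 - α)) * P := by field_simp; ring
        have e2 : 1 / β * (P * β) = P := by field_simp
        rw [e1, e2, hD]; ring
    _ ≤ ENNReal.ofReal (D.toReal + 1) * ENNReal.ofReal ((Λ ^ (-(n * (1 / 2 - α))) * N) ^ P) := by
        gcongr
        rw [← ENNReal.ofReal_toReal hDt]
        apply ENNReal.ofReal_le_ofReal
        rw [ENNReal.toReal_ofReal ENNReal.toReal_nonneg]
        linarith
    _ = _ := by
        rw [← ENNReal.ofReal_mul (by positivity)]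
        congr 1
        rw [mul_assoc ((D.toReal + 1) ^ (1 / P)), Real.mul_rpow (x := (D.toReal + 1) ^ (1 / P)) (by positivity) (by positivity),
          ← Real.rpow_mul (x := D.toReal + 1) (by positivity)]
        have : 1 / P * P = 1 := by field_simp
        rw [this, Real.rpow_one]

theorem decRear_bound {n : ℕ} (F : Eucl n → ℝ) (W : Eucl n → ℝ≥0∞) (hW : Measurable W)
    (hFW : ∀ x, ‖F x‖ₑ ≤ W x) (P B t : ℝ) (hP : 0 < P) (hB : 0 < B) (ht : 0 < t)
    (h : ∫⁻ x, W x ^ P ≤ ENNReal.ofReal (B ^ P)) :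
    decRear F t ≤ ENNReal.ofReal (B * t ^ (-(1 / P))) := by
  set s : ℝ≥0 := (B * t ^ (-(1 / P))).toNNReal with hs
  have hs0 : 0 < B * t ^ (-(1 / P)) := by positivity
  have hsc : (s : ℝ) = B * t ^ (-(1 / P)) := Real.coe_toNNReal _ hs0.le
  have hv : volume {x : Eucl n | (s : ℝ) < |F x|} ≤ ENNReal.ofReal t := by
    have h1 : {x : Eucl n | (s : ℝ) < |F x|} ⊆ {x | ENNReal.ofReal ((B * t ^ (-(1 / P))) ^ P) ≤ W x ^ P} := by
      intro x hx
      have hx' : B * t ^ (-(1 / P)) < |F x| := by rw [← hsc]; exact hx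
      show ENNReal.ofReal ((B * t ^ (-(1 / P))) ^ P) ≤ W x ^ P
      rw [← ENNReal.ofReal_rpow_of_nonneg hs0.le hP.le]
      gcongr
      refine le_trans ?_ (hFW x)
      rw [← ofReal_norm]
      exact ENNReal.ofReal_le_ofReal hx'.le
    have h2 := mul_meas_ge_le_lintegral (μ := volume) (hW.pow_const P) (ENNReal.ofReal ((B * t ^ (-(1 / P))) ^ P))
    have h3 : (B * t ^ (-(1 / P))) ^ P = B ^ P * t⁻¹ := by
      rw [Real.mul_rpow hB.le (by positivity), ← Real.rpow_mul ht.le]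
      have : -(1 / P) * P = -1 := by field_simp
      rw [this, Real.rpow_neg_one]
    refine (measure_mono h1).trans ?_
    set m := volume {x | ENNReal.ofReal ((B * t ^ (-(1 / P))) ^ P) ≤ W x ^ P} with hm
    have h4 := h2.trans h
    have h5 : 0 < B ^ P * t⁻¹ := by positivity
    rw [h3] at h4
    have h6 : m ≤ ENNReal.ofReal (B ^ P) / ENNReal.ofReal (B ^ P * t⁻¹) := by
      rw [ENNReal.le_div_iff_mul_le (Or.inl (by simpa using h5)) (Or.inl ENNReal.ofReal_ne_top), mul_comm]
      exact h4
    rw [← ENNReal.ofReal_div_of_pos h5] at h6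
    refine h6.trans (le_of_eq ?_)
    congr 1; field_simp
  exact iInf₂_le s hv

theorem weak_of_lorentz {n : ℕ} (f : Eucl n → ℝ) (p N : ℝ) (hp : 1 < p) (hN : 0 < N)
    (h : lorentzNorm (ENNReal.ofReal p) ∞ f < ENNReal.ofReal N) (l : ℝ) (hl : 0 < l) :
    volume {x | l < |f x|} ≤ ENNReal.ofReal ((N / l) ^ p) := by
  have hp0 : 0 < p := by linarith
  simp only [lorentzNorm, if_true, ENNReal.ofReal_ne_top, if_false] at h
  have hpr : (1 / ENNReal.ofReal p).toReal = 1 / p := by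
    rw [ENNReal.toReal_div, ENNReal.toReal_one, ENNReal.toReal_ofReal hp0.le]
  rw [hpr] at h
  set t := (N / l) ^ p with ht
  have ht0 : 0 < t := by positivity
  have h1 := (le_iSup (fun t : {t : ℝ // 0 < t} => ENNReal.ofReal (t.1 ^ (1 / p)) * decRear f t.1) ⟨t, ht0⟩).trans_lt h
  simp only at h1
  have h2 : t ^ (1 / p) = N / l := by
    rw [ht, ← Real.rpow_mul (by positivity)]
    have : p * (1 / p) = 1 := by field_simp
    rw [this, Real.rpow_one]
  rw [h2] at h1
  have h3 : decRear f t < ENNReal.ofReal l := by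
    by_contra hcon
    push Not at hcon
    have : ENNReal.ofReal (N / l) * ENNReal.ofReal l ≤ ENNReal.ofReal (N / l) * decRear f t := by gcongr
    rw [← ENNReal.ofReal_mul (by positivity), div_mul_cancel₀ _ hl.ne'] at this
    exact absurd h1 (not_lt.2 this)
  unfold decRear at h3
  rw [iInf_lt_iff] at h3
  obtain ⟨s, hs⟩ := h3
  rw [iInf_lt_iff] at hs
  obtain ⟨hs1, hs2⟩ := hs
  refine (measure_mono fun x hx => ?_).trans hs1
  have : (s : ℝ) < l := by
    rw [ENNReal.ofReal, ENNReal.coe_lt_coe] at hs2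
    exact (Real.lt_toNNReal_iff_coe_lt).1 hs2
  exact this.trans hx

theorem lorentz_aux {n : ℕ} (p : ℝ) (hp : 1 < p) (q : ℝ≥0∞) (hq : 1 ≤ q) (δ ε : ℝ) (hδ : 0 < δ) (hε : 0 < ε) :
    ∃ K : ℝ, 0 < K ∧ ∀ (F : Eucl n → ℝ) (M T : ℝ), 0 < M → 0 < T →
      (∀ t : ℝ, 0 < t → ENNReal.ofReal (t ^ (1 / p)) * decRear F t ≤ ENNReal.ofReal (M * (t / T) ^ δ)) →
      (∀ t : ℝ, 0 < t → ENNReal.ofReal (t ^ (1 / p)) * decRear F t ≤ ENNReal.ofReal (M * (t / T) ^ (-ε))) →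
      lorentzNorm (ENNReal.ofReal p) q F ≤ ENNReal.ofReal (K * M) := by
  have hp0 : 0 < p := by linarith
  have hpr : (1 / ENNReal.ofReal p).toReal = 1 / p := by
    rw [ENNReal.toReal_div, ENNReal.toReal_one, ENNReal.toReal_ofReal hp0.le]
  by_cases hqt : q = ∞
  · refine ⟨1, one_pos, ?_⟩
    intro F M T hM hT h1 h2
    simp only [lorentzNorm, hqt, if_true, ENNReal.ofReal_ne_top, if_false, hpr, one_mul]
    refine iSup_le fun t => ?_
    have ht := t.2
    rcases le_total t.1 T with h | h
    · refine (h1 t.1 ht).trans (ENNReal.ofReal_le_ofReal ?_)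
      have : (t.1 / T) ^ δ ≤ 1 := Real.rpow_le_one (by positivity) ((div_le_one hT).2 h) hδ.le
      nlinarith
    · refine (h2 t.1 ht).trans (ENNReal.ofReal_le_ofReal ?_)
      have : (t.1 / T) ^ (-ε) ≤ 1 := Real.rpow_le_one_of_one_le_of_nonpos ((one_le_div hT).2 h) (by linarith)
      nlinarith
  · set Q := q.toReal with hQ
    have hQ1 : 1 ≤ Q := by
      rw [hQ, ← ENNReal.toReal_one]; exact ENNReal.toReal_mono hqt hq
    have hQ0 : 0 < Q := by linarith
    refine ⟨(1 / (δ * Q) + 1 / (ε * Q)) ^ (1 / Q), by positivity, ?_⟩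
    intro F M T hM hT h1 h2
    simp only [lorentzNorm, hqt, if_false, hpr]
    have pw : ∀ (t d : ℝ), 0 < t → ENNReal.ofReal (t ^ (1 / p)) * decRear F t ≤ ENNReal.ofReal (M * (t / T) ^ d) →
        (ENNReal.ofReal (t ^ (1 / p)) * decRear F t) ^ Q / ENNReal.ofReal t ≤
          ENNReal.ofReal (M ^ Q * T ^ (-(d * Q))) * ENNReal.ofReal (t ^ (d * Q - 1)) := by
      intro t d ht h
      calc _ ≤ ENNReal.ofReal (M * (t / T) ^ d) ^ Q / ENNReal.ofReal t := by gcongr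
        _ = _ := by
          rw [ENNReal.ofReal_rpow_of_nonneg (by positivity) hQ0.le, ← ENNReal.ofReal_div_of_pos ht,
            ← ENNReal.ofReal_mul (by positivity)]
          congr 1
          rw [Real.mul_rpow hM.le (by positivity), ← Real.rpow_mul (by positivity), Real.div_rpow ht.le hT.le,
            Real.rpow_neg hT.le, Real.rpow_sub_one ht.ne']
          ring
    have key : ∫⁻ t in Ioi (0:ℝ), (ENNReal.ofReal (t ^ (1 / p)) * decRear F t) ^ Q / ENNReal.ofReal t ≤
        ENNReal.ofReal ((1 / (δ * Q) + 1 / (ε * Q)) * M ^ Q) := by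
      rw [← Ioc_union_Ioi_eq_Ioi hT.le, lintegral_union measurableSet_Ioi (Ioc_disjoint_Ioi le_rfl)]
      have a1 : ∫⁻ t in Ioc 0 T, (ENNReal.ofReal (t ^ (1 / p)) * decRear F t) ^ Q / ENNReal.ofReal t ≤
          ENNReal.ofReal (1 / (δ * Q) * M ^ Q) := by
        calc _ ≤ ∫⁻ t in Ioc 0 T, ENNReal.ofReal (M ^ Q * T ^ (-(δ * Q))) * ENNReal.ofReal (t ^ (δ * Q - 1)) :=
              setLIntegral_mono' measurableSet_Ioc fun t ht => pw t δ ht.1 (h1 t ht.1)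
          _ = _ := by
            rw [lintegral_const_mul' _ _ ENNReal.ofReal_ne_top, lintegral_Ioc_rpow_aux hT (by positivity),
              ← ENNReal.ofReal_mul (by positivity), Real.rpow_neg hT.le]
            congr 1; field_simp
      have a2 : ∫⁻ t in Ioi T, (ENNReal.ofReal (t ^ (1 / p)) * decRear F t) ^ Q / ENNReal.ofReal t ≤
          ENNReal.ofReal (1 / (ε * Q) * M ^ Q) := by
        calc _ ≤ ∫⁻ t in Ioi T, ENNReal.ofReal (M ^ Q * T ^ (-(-ε * Q))) * ENNReal.ofReal (t ^ (-(ε * Q) - 1)) := by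
              refine setLIntegral_mono' measurableSet_Ioi fun t ht => ?_
              have ht0 : 0 < t := hT.trans ht
              have := pw t (-ε) ht0 (h2 t ht0)
              rwa [neg_mul ε Q] at this ⊢
          _ = _ := by
            rw [lintegral_const_mul' _ _ ENNReal.ofReal_ne_top, lintegral_Ioi_rpow_aux hT (by positivity),
              ← ENNReal.ofReal_mul (by positivity), neg_mul, neg_neg, Real.rpow_neg hT.le]
            congr 1; field_simp
      calc _ ≤ _ := add_le_add a1 a2
        _ = _ := by
          rw [← ENNReal.ofReal_add (by positivity) (by positivity)]
          congr 1; ring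
    calc _ ≤ ENNReal.ofReal ((1 / (δ * Q) + 1 / (ε * Q)) * M ^ Q) ^ (1 / Q) := by gcongr
      _ = _ := by
        rw [ENNReal.ofReal_rpow_of_nonneg (by positivity) (by positivity), Real.mul_rpow (by positivity) (by positivity),
          ← Real.rpow_mul hM.le]
        have : Q * (1 / Q) = 1 := by field_simp
        rw [this, Real.rpow_one]

theorem scaled_dec {n : ℕ} (p P : ℝ) (hp : 0 < p) (hP : 0 < P) (F : Eucl n → ℝ)
    (V : Eucl n → ℝ≥0∞) (hV : Measurable V) (x₀ : Eucl n) (r : ℝ) (hr : 0 < r) (M : ℝ) (hM : 0 < M)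
    (hF : ∀ x, ‖F x‖ₑ ≤ V (r⁻¹ • (x - x₀)))
    (hI : ∫⁻ x, V x ^ P ≤ ENNReal.ofReal ((M * r ^ (-((n:ℝ) / p))) ^ P)) (t : ℝ) (ht : 0 < t) :
    ENNReal.ofReal (t ^ (1 / p)) * decRear F t ≤
      ENNReal.ofReal (M * (t / r ^ n) ^ (1 / p - 1 / P)) := by
  have hm : Measurable (fun x => V (r⁻¹ • (x - x₀))) := hV.comp (by fun_prop)
  have hB : 0 < r ^ ((n:ℝ) / P) * (M * r ^ (-((n:ℝ) / p))) := by positivity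
  have h := decRear_bound F _ hm hF P (r ^ ((n:ℝ) / P) * (M * r ^ (-((n:ℝ) / p)))) t hP hB ht (by
    rw [lintegral_scale (fun x => V x ^ P) (hV.pow_const _) x₀ r hr, Real.mul_rpow (by positivity) (by positivity),
      ENNReal.ofReal_mul (by positivity), ← Real.rpow_mul hr.le, div_mul_cancel₀ _ hP.ne', Real.rpow_natCast]
    gcongr)
  calc _ ≤ ENNReal.ofReal (t ^ (1 / p)) * ENNReal.ofReal (r ^ ((n:ℝ) / P) * (M * r ^ (-((n:ℝ) / p))) * t ^ (-(1 / P))) := by gcongr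
    _ = _ := by
      rw [← ENNReal.ofReal_mul (by positivity)]
      congr 1
      rw [Real.div_rpow ht.le (by positivity), ← Real.rpow_natCast, ← Real.rpow_mul hr.le, div_eq_mul_inv (t ^ (1 / p - 1 / P)),
        ← Real.rpow_neg hr.le]
      have e1 : t ^ (1 / p - 1 / P) = t ^ (1 / p) * t ^ (-(1 / P)) := by
        rw [← Real.rpow_add ht]; ring_nf
      have e2 : r ^ (-((n:ℝ) * (1 / p - 1 / P))) = r ^ ((n:ℝ) / P) * r ^ (-((n:ℝ) / p)) := by
        rw [← Real.rpow_add hr]; ring_nf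
      rw [e1, e2]; ring

theorem scaled_weak {n : ℕ} (p : ℝ) (hp : 0 < p) (φ : Eucl n → ℝ) (hφ : Measurable φ) (x₀ : Eucl n) (r : ℝ)
    (hr : 0 < r) (N : ℝ) (hN : 0 < N)
    (h : ∀ l : ℝ, 0 < l → volume {x | l < |φ x|} ≤ ENNReal.ofReal ((N / l) ^ p)) (l : ℝ) (hl : 0 < l) :
    volume {z | l < |φ (x₀ + r • z)|} ≤ ENNReal.ofReal ((r ^ (-((n:ℝ) / p)) * N / l) ^ p) := by
  have hS : MeasurableSet {z : Eucl n | l < |φ (x₀ + r • z)|} := by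
    have : Measurable (fun z : Eucl n => φ (x₀ + r • z)) := hφ.comp (by fun_prop)
    exact measurableSet_lt measurable_const (by fun_prop)
  have hS' : MeasurableSet {z : Eucl n | l < |φ z|} :=
    measurableSet_lt measurable_const (by fun_prop)
  have h1 := lintegral_scale (Set.indicator {z : Eucl n | l < |φ (x₀ + r • z)|} 1)
    (measurable_one.indicator hS) x₀ r hr
  have h2 : ∀ x : Eucl n, Set.indicator {z : Eucl n | l < |φ (x₀ + r • z)|} (1 : Eucl n → ℝ≥0∞) (r⁻¹ • (x - x₀)) =
      Set.indicator {z : Eucl n | l < |φ z|} 1 x := by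
    intro x
    simp only [Set.indicator, Set.mem_ofPred_eq, smul_smul, mul_inv_cancel₀ hr.ne', one_smul, add_sub_cancel, Pi.one_apply]
  simp only [h2] at h1
  rw [lintegral_indicator_one hS, lintegral_indicator_one hS'] at h1
  have h3 : volume {z : Eucl n | l < |φ (x₀ + r • z)|} = ENNReal.ofReal (r ^ (-(n:ℝ))) * volume {z : Eucl n | l < |φ z|} := by
    rw [h1, ← mul_assoc, ← ENNReal.ofReal_mul (by positivity), ← Real.rpow_natCast, ← Real.rpow_add hr]
    simp
  rw [h3]
  calc _ ≤ ENNReal.ofReal (r ^ (-(n:ℝ))) * ENNReal.ofReal ((N / l) ^ p) := by gcongr; exact h l hl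
    _ = _ := by
      rw [← ENNReal.ofReal_mul (by positivity), mul_div_assoc, Real.mul_rpow (by positivity) (by positivity),
        ← Real.rpow_mul hr.le]
      congr 3
      field_simp

theorem main_estimate (n : ℕ) (hn : 1 ≤ n) (p : ℝ) (hp : 1 < p) (q : ℝ≥0∞) (hq : 1 ≤ q)
    (η : Eucl n → ℝ) (hη : ContDiff ℝ (⊤ : ℕ∞) η) (hηc : HasCompactSupport η) :
    ∃ C > (0:ℝ), ∃ γ > (0:ℝ), ∀ (x₀ : Eucl n) (r Λ : ℝ), 0 < r → 1 ≤ Λ →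
      ∀ φ : Eucl n → ℝ, IsTestFn (ball x₀ r) φ →
        ∀ N : ℝ, 0 < N → lorentzNorm (ENNReal.ofReal p) ∞ φ < ENNReal.ofReal N →
        lorentzNorm (ENNReal.ofReal p) q
            (fun x => fracLap ((n:ℝ)/2) (fun y => η ((Λ * r)⁻¹ • (y - x₀))) x *
              rieszPot ((n:ℝ)/2) φ x) ≤
          ENNReal.ofReal (C * Λ ^ (-γ) * N) := by
  have hn' : (0:ℝ) < n := by exact_mod_cast hn
  have hp0 : 0 < p := by linarith
  have hip : 0 < 1 / p := by positivity
  have hip1 : 1 / p < 1 := by rw [div_lt_one (by linarith)]; exact hp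
  obtain ⟨a, ha1, ha2⟩ := exists_between hip1
  obtain ⟨b, hb1, hb2⟩ : ∃ b, max 0 (1 / p - 1 / 2) < b ∧ b < 1 / p := exists_between (by
    rw [max_lt_iff]; constructor <;> linarith)
  rw [max_lt_iff] at hb1
  obtain ⟨hb0, hb1⟩ := hb1
  have ha0 : 0 < a := by linarith
  obtain ⟨hGc, hG⟩ := fracLap_eta ((n:ℝ)/2) (by positivity) η hη hηc
  set G := fracLap ((n:ℝ)/2) η with hGdef
  set R := ‖rieszConst n ((n:ℝ)/2)‖ₑ with hRdef
  obtain ⟨C1, hC1, γ1, hγ1, H1⟩ := unit_bound hn p (1 / a) hp (by rw [lt_div_iff₀ ha0]; linarith)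
    (by rw [one_div_one_div]; linarith) G hGc.measurable hG R enorm_ne_top
  obtain ⟨C2, hC2, γ2, hγ2, H2⟩ := unit_bound hn p (1 / b) hp (by rw [lt_div_iff₀ hb0]; linarith)
    (by rw [one_div_one_div]; linarith) G hGc.measurable hG R enorm_ne_top
  obtain ⟨K, hK, HK⟩ := lorentz_aux (n := n) p hp q hq (1 / p - b) (a - 1 / p) (by linarith) (by linarith)
  refine ⟨K * max C1 C2, by positivity, min γ1 γ2, by positivity, ?_⟩
  intro x₀ r Λ hr hΛ φ hφ N hN hφN
  have hΛ0 : 0 < Λ := by linarith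
  have hM : 0 < max C1 C2 * Λ ^ (-(min γ1 γ2)) * N := by positivity
  have hw := weak_of_lorentz φ p N hp hN hφN
  have mφ : Measurable φ := hφ.1.continuous.measurable
  set ψ : Eucl n → ℝ := fun z => φ (x₀ + r • z) with hψ
  have mψ : Measurable ψ := mφ.comp (by fun_prop)
  have hψw := scaled_weak p hp0 φ mφ x₀ r hr N hN hw
  have hψs : ∀ z, z ∉ ball (0 : Eucl n) 1 → ψ z = 0 := by
    intro z hz
    by_contra hne
    apply hz
    have : x₀ + r • z ∈ ball x₀ r := hφ.2.2 (subset_tsupport _ hne)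
    simp only [mem_ball_iff_norm, add_sub_cancel_left, norm_smul, Real.norm_of_nonneg hr.le, sub_zero] at this ⊢
    nlinarith
  have hNψ : 0 < r ^ (-((n:ℝ) / p)) * N := by positivity
  set V : Eucl n → ℝ≥0∞ := fun x => ENNReal.ofReal (Λ ^ (-((n:ℝ)/2))) * ‖G (Λ⁻¹ • x)‖ₑ * (R * Upot ψ x) with hVdef
  have mV : Measurable V := by
    have m1 : Measurable (fun x : Eucl n => G (Λ⁻¹ • x)) := hGc.measurable.comp (by fun_prop)
    have m2 := measurable_Upot ψ mψ
    exact (m1.enorm.const_mul _).mul (m2.const_mul _)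
  have I1 := H1 Λ ψ _ hΛ mψ hNψ hψs hψw
  have I2 := H2 Λ ψ _ hΛ mψ hNψ hψs hψw
  have c1 : C1 * Λ ^ (-γ1) ≤ max C1 C2 * Λ ^ (-(min γ1 γ2)) := by
    gcongr
    · exact le_max_left _ _
    · exact min_le_left _ _
  have c2 : C2 * Λ ^ (-γ2) ≤ max C1 C2 * Λ ^ (-(min γ1 γ2)) := by
    gcongr
    · exact le_max_right _ _
    · exact min_le_right _ _
  have J1 : ∫⁻ x, V x ^ (1 / a) ≤
      ENNReal.ofReal ((max C1 C2 * Λ ^ (-(min γ1 γ2)) * N * r ^ (-((n:ℝ) / p))) ^ (1 / a)) := by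
    refine I1.trans (ENNReal.ofReal_le_ofReal ?_)
    rw [mul_assoc (max C1 C2 * Λ ^ (-(min γ1 γ2))), mul_comm N]
    gcongr
  have J2 : ∫⁻ x, V x ^ (1 / b) ≤
      ENNReal.ofReal ((max C1 C2 * Λ ^ (-(min γ1 γ2)) * N * r ^ (-((n:ℝ) / p))) ^ (1 / b)) := by
    refine I2.trans (ENNReal.ofReal_le_ofReal ?_)
    rw [mul_assoc (max C1 C2 * Λ ^ (-(min γ1 γ2))), mul_comm N]
    gcongr
  set F : Eucl n → ℝ := fun x => fracLap ((n:ℝ)/2) (fun y => η ((Λ * r)⁻¹ • (y - x₀))) x *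
              rieszPot ((n:ℝ)/2) φ x with hFdef
  have hFV : ∀ x, ‖F x‖ₑ ≤ V (r⁻¹ • (x - x₀)) := by
    intro x
    have e : F x = Λ ^ (-((n:ℝ)/2)) * G (Λ⁻¹ • (r⁻¹ • (x - x₀))) * rieszPot ((n:ℝ)/2) ψ (r⁻¹ • (x - x₀)) := by
      rw [hFdef]
      simp only
      rw [fracLap_scale ((n:ℝ)/2) η x₀ x (Λ * r) (by positivity), rieszPot_scale ((n:ℝ)/2) φ x₀ x r hr,
        smul_smul, ← mul_inv, Real.mul_rpow hΛ0.le hr.le]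
      have : r ^ (-((n:ℝ)/2)) * r ^ ((n:ℝ)/2) = 1 := by
        rw [← Real.rpow_add hr]; simp
      linear_combination (Λ ^ (-((n:ℝ)/2)) * G ((Λ * r)⁻¹ • (x - x₀)) * rieszPot ((n:ℝ)/2) ψ (r⁻¹ • (x - x₀))) * this
    rw [e, enorm_mul, enorm_mul, Real.enorm_of_nonneg (by positivity)]
    simp only [hVdef]
    gcongr
    exact enorm_rieszPot_le _ _
  have hfin := HK F (max C1 C2 * Λ ^ (-(min γ1 γ2)) * N) (r ^ n) hM (by positivity)
    (fun t ht => by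
      have := scaled_dec p (1 / b) hp0 (by positivity) F V mV x₀ r hr _ hM hFV J2 t ht
      rwa [one_div_one_div] at this)
    (fun t ht => by
      have := scaled_dec p (1 / a) hp0 (by positivity) F V mV x₀ r hr _ hM hFV J1 t ht
      rw [one_div_one_div] at this
      rwa [neg_sub])
  refine hfin.trans (le_of_eq ?_)
  congr 1; ring

/-- estimate for `(Δ^{n/4} η_{Λr}) · (Δ^{-n/4} φ)`. -/
theorem statement_13 (n : ℕ) (hn : 1 ≤ n) (p : ℝ) (hp : 1 < p) (q : ℝ≥0∞) (hq : 1 ≤ q)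
    (η : Eucl n → ℝ) (hη : ContDiff ℝ (⊤ : ℕ∞) η) (hηsupp : tsupport η ⊆ ball (0 : Eucl n) 2)
    (hη1 : Set.EqOn η 1 (ball (0 : Eucl n) 1)) :
    ∃ C > (0:ℝ), ∃ γ > (0:ℝ), ∀ (x₀ : Eucl n) (r Λ : ℝ), 0 < r → 1 ≤ Λ →
      ∀ φ : Eucl n → ℝ, IsTestFn (ball x₀ r) φ →
        lorentzNorm (ENNReal.ofReal p) q
            (fun x => fracLap ((n:ℝ)/2) (fun y => η ((Λ * r)⁻¹ • (y - x₀))) x *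
              rieszPot ((n:ℝ)/2) φ x) ≤
          ENNReal.ofReal (C * Λ ^ (-γ)) * lorentzNorm (ENNReal.ofReal p) ∞ φ := by
  have hc : HasCompactSupport η :=
    (isCompact_closedBall (0 : Eucl n) 2).of_isClosed_subset (isClosed_tsupport _)
      (hηsupp.trans ball_subset_closedBall)
  obtain ⟨C, hC, γ, hγ, H⟩ := main_estimate n hn p hp q hq η hη hc
  refine ⟨C, hC, γ, hγ, ?_⟩
  intro x₀ r Λ hr hΛ φ hφ
  have H' := H x₀ r Λ hr hΛ φ hφ
  have hc0 : 0 < C * Λ ^ (-γ) := by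
    have : 0 < Λ := by linarith
    positivity
  set A := lorentzNorm (ENNReal.ofReal p) ∞ φ with hA
  by_cases hAt : A = ∞
  · rw [hAt, ENNReal.mul_top (by simpa using hc0)]
    exact le_top
  rw [← ENNReal.ofReal_toReal hAt, ← ENNReal.ofReal_mul hc0.le]
  refine ENNReal.le_of_forall_pos_le_add fun e he _ => ?_
  have he' : (0:ℝ) < e := he
  have hAn : 0 ≤ A.toReal := ENNReal.toReal_nonneg
  have hd : 0 < (e:ℝ) / (C * Λ ^ (-γ)) := by positivity
  refine (H' (A.toReal + e / (C * Λ ^ (-γ))) (by positivity) ?_).trans (le_of_eq ?_)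
  · rw [ENNReal.lt_ofReal_iff_toReal_lt hAt]; linarith
  · rw [mul_add, mul_div_cancel₀ _ hc0.ne', ENNReal.ofReal_add (by positivity) (by positivity), ENNReal.ofReal_coe_nnreal]
end
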